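/- arXiv:2603.07722 — 2 statements merged into one kernel-verified Lean document; each statement's English description precedes it below -/
import Mathlib

section
/- Reducibility under failure of the interior condition (Theorem B.2, part 2). Suppose Assumption 1 holds, 𝓕 is convex, and r₁(·;θ) is F-integrable for every F ∈ 𝓕. Fix θ ∈ Θ, suppose 𝓕'_θ is nonempty and that there exists no F ∈ 𝓕 with ∫ r₁(z;θ) dF = 0 and inf_{λ ∈ 𝒮₂} ∫ γ₂(λ,z;θ) dF > 0. Let λ̃ ∈ 𝒮₂ satisfy ∫ γ₂(λ̃,z;θ) dF = 0 for every F ∈ 𝓕'_θ. Then for any vectors λ₂, …, λ_{dim r₂} such that λ̃, λ₂, …, λ_{dim r₂} are linearly independent, defining Γ̃(θ) = {(u,z) ∈ Γ(θ) : λ̃ᵀ r₂(u,z;θ) = γ₂(λ̃,z;θ)} and r̃(u,z;θ) = (r₁(z;θ), γ₂(λ̃,z;θ), λ₂ᵀ r₂(u,z;θ), …, λ_{dim r₂}ᵀ r₂(u,z;θ)), one has for every F ∈ 𝓕: θ ∈ Θ_I(F;Γ,r) if and only if θ ∈ Θ_I(F;Γ̃,r̃). In particular, the model (Γ,r) is reducible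 at θ. -/
open MeasureTheory Set
open scoped ENNReal RealInnerProductSpace

noncomputable section

/-- The positive part of an extended real, as an extended nonnegative real. -/
def EReal.posPart (x : EReal) : ℝ≥0∞ := if x = ⊤ then ⊤ else ENNReal.ofReal x.toReal

/-- The integral of an `EReal`-valued function: the integral of its positive part
minus the integral of its negative part (an element of `EReal`). -/
def integralEReal {𝓩 : Type*} [MeasurableSpace 𝓩] (F : Measure 𝓩) (f : 𝓩 → EReal) : EReal :=
  ((∫⁻ z, (f z).posPart ∂F : ℝ≥0∞) : EReal) - ((∫⁻ z, (-(f z)).posPart ∂F : ℝ≥0∞) : EReal)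

variable {𝓤 𝓩 : Type*}
  [MeasurableSpace 𝓤] [TopologicalSpace 𝓤] [PolishSpace 𝓤] [BorelSpace 𝓤]
  [MeasurableSpace 𝓩] [TopologicalSpace 𝓩] [PolishSpace 𝓩] [BorelSpace 𝓩]
  {Θ : Type*}

/-- The section `Γ(z;θ) = {u : (u,z) ∈ Γ(θ)}`. -/
def sectionSet (Γθ : Set (𝓤 × 𝓩)) (z : 𝓩) : Set 𝓤 := {u | (u, z) ∈ Γθ}

/-- The set `𝓡(z;θ)` of moment values consistent with the support restriction at `z`. -/
def momentSet {d : ℕ} (Γθ : Set (𝓤 × 𝓩)) (rθ : 𝓤 → 𝓩 → EuclideanSpace ℝ (Fin d)) (z : 𝓩) :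
    Set (EuclideanSpace ℝ (Fin d)) := (fun u => rθ u z) '' sectionSet Γθ z

/-- The support function `γ(λ,z;θ) = sup {λᵀt : t ∈ 𝓡(z;θ)}`, with values in `EReal`. -/
def suppFun {d : ℕ} (Γθ : Set (𝓤 × 𝓩)) (rθ : 𝓤 → 𝓩 → EuclideanSpace ℝ (Fin d))
    (l : EuclideanSpace ℝ (Fin d)) (z : 𝓩) : EReal :=
  sSup ((fun t => ((⟪l, t⟫ : ℝ) : EReal)) '' momentSet Γθ rθ z)

/-- Assumption 1 at a single parameter value and a single distribution. -/
structure Assumption1At {d : ℕ} (F : Measure 𝓩) (Γθ : Set (𝓤 × 𝓩))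
    (rθ : 𝓤 → 𝓩 → EuclideanSpace ℝ (Fin d)) : Prop where
  borel_Gamma : MeasurableSet Γθ
  nonempty_section : ∀ z, (sectionSet Γθ z).Nonempty
  borel_section : ∀ z, MeasurableSet (sectionSet Γθ z)
  measurable_r : Measurable fun p : 𝓤 × 𝓩 => rθ p.1 p.2
  lower_envelope : ∃ g : 𝓩 → ℝ, Measurable g ∧ Integrable g F ∧
    ∀ᵐ z ∂F, sInf (norm '' momentSet Γθ rθ z) ≤ g z

/-- Assumption 1: measurability, nonempty sections, and an integrable lower envelope for
the infimum of the norm over the moment set. -/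
def Assumption1 {d : ℕ} (𝓕 : Set (Measure 𝓩)) (Γ : Θ → Set (𝓤 × 𝓩))
    (r : Θ → 𝓤 → 𝓩 → EuclideanSpace ℝ (Fin d)) : Prop :=
  ∀ θ : Θ, ∀ F ∈ 𝓕, Assumption1At F (Γ θ) (r θ)

/-- Assumption 2 at a single parameter value and distribution: closedness and
integrable boundedness of the moment sets. -/
structure Assumption2At {d : ℕ} (F : Measure 𝓩) (Γθ : Set (𝓤 × 𝓩))
    (rθ : 𝓤 → 𝓩 → EuclideanSpace ℝ (Fin d)) : Prop where
  closed_momentSet : ∀ᵐ z ∂F, IsClosed (momentSet Γθ rθ z)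
  upper_envelope : ∃ g : 𝓩 → ℝ, Measurable g ∧ Integrable g F ∧
    ∀ᵐ z ∂F, ∀ t ∈ momentSet Γθ rθ z, ‖t‖ ≤ g z

/-- Assumption 2 (closedness and integrable boundedness). -/
def Assumption2 {d : ℕ} (𝓕 : Set (Measure 𝓩)) (Γ : Θ → Set (𝓤 × 𝓩))
    (r : Θ → 𝓤 → 𝓩 → EuclideanSpace ℝ (Fin d)) : Prop :=
  ∀ θ : Θ, ∀ F ∈ 𝓕, Assumption2At F (Γ θ) (r θ)

/-- `θ` belongs to the identified set `Θ_I(F)`: there is a Borel probability measure `H`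
on `𝓤 × 𝓩` giving probability one to the support restriction, with `𝓩`-marginal `F`,
under which the moment function is integrable with mean zero. -/
def MemIdentified {d : ℕ} (Γθ : Set (𝓤 × 𝓩)) (rθ : 𝓤 → 𝓩 → EuclideanSpace ℝ (Fin d))
    (F : Measure 𝓩) : Prop :=
  ∃ H : Measure (𝓤 × 𝓩), IsProbabilityMeasure H ∧ H Γθ = 1 ∧ H.map Prod.snd = F ∧
    Integrable (fun p : 𝓤 × 𝓩 => rθ p.1 p.2) H ∧ (∫ p : 𝓤 × 𝓩, rθ p.1 p.2 ∂H) = 0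

/-- `θ` belongs to the moment closure `Θ̄_I(F)` of the identified set. -/
def MemMomentClosure {d : ℕ} (Γθ : Set (𝓤 × 𝓩)) (rθ : 𝓤 → 𝓩 → EuclideanSpace ℝ (Fin d))
    (F : Measure 𝓩) : Prop :=
  ∀ ε : ℝ, 0 < ε → ∃ H : Measure (𝓤 × 𝓩), IsProbabilityMeasure H ∧ H Γθ = 1 ∧
    H.map Prod.snd = F ∧ Integrable (fun p : 𝓤 × 𝓩 => rθ p.1 p.2) H ∧
    ‖∫ p : 𝓤 × 𝓩, rθ p.1 p.2 ∂H‖ ≤ ε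

/-- `θ` belongs to the support-function set `Θ̃(F)`:
`∫ γ(λ,z;θ) dF ≥ 0` for every `λ` in the unit sphere. -/
def MemSFSet {d : ℕ} (Γθ : Set (𝓤 × 𝓩)) (rθ : 𝓤 → 𝓩 → EuclideanSpace ℝ (Fin d))
    (F : Measure 𝓩) : Prop :=
  ∀ l : EuclideanSpace ℝ (Fin d), ‖l‖ = 1 → (0 : EReal) ≤ integralEReal F (suppFun Γθ rθ l)


/-- The combined moment function `r(u,z;θ) = (r₁(z;θ), r₂(u,z;θ))`, where `r₁` collects the
components that do not depend on the latent variable `u`. -/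
def rComb {d1 d2 : ℕ} (r1θ : 𝓩 → EuclideanSpace ℝ (Fin d1))
    (r2θ : 𝓤 → 𝓩 → EuclideanSpace ℝ (Fin d2)) (u : 𝓤) (z : 𝓩) :
    EuclideanSpace ℝ (Fin (d1 + d2)) :=
  (EuclideanSpace.equiv (Fin (d1 + d2)) ℝ).symm
    (Fin.append (EuclideanSpace.equiv (Fin d1) ℝ (r1θ z))
      (EuclideanSpace.equiv (Fin d2) ℝ (r2θ u z)))

/-- The partial support function `γ₂(λ,z;θ) = sup {λᵀ r₂(u,z;θ) : u ∈ Γ(z;θ)}`. -/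
def suppFun2 {d2 : ℕ} (Γθ : Set (𝓤 × 𝓩)) (r2θ : 𝓤 → 𝓩 → EuclideanSpace ℝ (Fin d2))
    (l : EuclideanSpace ℝ (Fin d2)) (z : 𝓩) : EReal :=
  sSup ((fun u => ((⟪l, r2θ u z⟫ : ℝ) : EReal)) '' sectionSet Γθ z)

/-- Convexity of a family of (probability) measures. -/
def ConvexFamily (𝓕 : Set (Measure 𝓩)) : Prop :=
  ∀ F₁ ∈ 𝓕, ∀ F₂ ∈ 𝓕, ∀ δ : ℝ, 0 ≤ δ → δ ≤ 1 →
    (ENNReal.ofReal δ • F₁ + ENNReal.ofReal (1 - δ) • F₂) ∈ 𝓕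

/-- Finite-sample indistinguishability of the hypotheses `θ ∈ Θ_I(F)` and `θ ∈ Θ̄_I(F)`:
for every sample size `n` and every (measurable, `[0,1]`-valued) test `φ`, the supremum of the
rejection probability over `𝓕_θ` equals the supremum over `𝓕̄_θ`. -/
def Indistinguishable {d : ℕ} (𝓕 : Set (Measure 𝓩)) (Γθ : Set (𝓤 × 𝓩))
    (rθ : 𝓤 → 𝓩 → EuclideanSpace ℝ (Fin d)) : Prop :=
  ∀ (n : ℕ) (φ : (Fin n → 𝓩) → ℝ), Measurable φ → (∀ x, φ x ∈ Set.Icc (0 : ℝ) 1) →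
    sSup ((fun F : Measure 𝓩 => ∫ x, φ x ∂(Measure.pi fun _ : Fin n => F)) ''
        {F ∈ 𝓕 | MemIdentified Γθ rθ F}) =
      sSup ((fun F : Measure 𝓩 => ∫ x, φ x ∂(Measure.pi fun _ : Fin n => F)) ''
        {F ∈ 𝓕 | MemMomentClosure Γθ rθ F})

/-- The support restriction of the reduced model: the subset of `Γ(θ)` on which
`λ₁ᵀ r₂(u,z;θ)` attains the support-function value `γ₂(λ₁,z;θ)`. -/
def redGamma {d2 : ℕ} (Γθ : Set (𝓤 × 𝓩)) (r2θ : 𝓤 → 𝓩 → EuclideanSpace ℝ (Fin d2))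
    (l1 : EuclideanSpace ℝ (Fin d2)) : Set (𝓤 × 𝓩) :=
  {p ∈ Γθ | ((⟪l1, r2θ p.1 p.2⟫ : ℝ) : EReal) = suppFun2 Γθ r2θ l1 p.2}

/-- The moment function of the reduced model:
`r̃(u,z;θ) = (r₁(z;θ), γ₂(λ₁,z;θ), λ₂ᵀ r₂(u,z;θ), …, λ_{dim r₂}ᵀ r₂(u,z;θ))`. -/
def redR {d1 d2 : ℕ} (Γθ : Set (𝓤 × 𝓩)) (r1θ : 𝓩 → EuclideanSpace ℝ (Fin d1))
    (r2θ : 𝓤 → 𝓩 → EuclideanSpace ℝ (Fin d2)) (h : 0 < d2)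
    (lam : Fin d2 → EuclideanSpace ℝ (Fin d2)) (u : 𝓤) (z : 𝓩) :
    EuclideanSpace ℝ (Fin (d1 + d2)) :=
  (EuclideanSpace.equiv (Fin (d1 + d2)) ℝ).symm
    (Fin.append (EuclideanSpace.equiv (Fin d1) ℝ (r1θ z))
      (fun i : Fin d2 =>
        if (i : ℕ) = 0 then (suppFun2 Γθ r2θ (lam ⟨0, h⟩) z).toReal
        else ⟪lam i, r2θ u z⟫))

/-- The model `(Γ, r)` with `r = (r₁, r₂)` is reducible: at some `θ` there exist
`dim r₂` linearly independent vectors `λ₁, …, λ_{dim r₂}` such that the corresponding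
reduced model has the same identified set as `(Γ, r)` for every `F ∈ 𝓕`. -/
def Reducible {d1 d2 : ℕ} (𝓕 : Set (Measure 𝓩)) (Γ : Θ → Set (𝓤 × 𝓩))
    (r1 : Θ → 𝓩 → EuclideanSpace ℝ (Fin d1))
    (r2 : Θ → 𝓤 → 𝓩 → EuclideanSpace ℝ (Fin d2)) : Prop :=
  ∃ (θ : Θ) (h : 0 < d2) (lam : Fin d2 → EuclideanSpace ℝ (Fin d2)),
    LinearIndependent ℝ lam ∧
    ∀ F ∈ 𝓕, (MemIdentified (Γ θ) (rComb (r1 θ) (r2 θ)) F ↔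
      MemIdentified (redGamma (Γ θ) (r2 θ) (lam ⟨0, h⟩)) (redR (Γ θ) (r1 θ) (r2 θ) h lam) F)

/-- Inner approximation of the range of a continuous function on Baire space by the images of
compact sets. -/
theorem exists_isCompact_le_measure_image {α : Type*} [MeasurableSpace α] [TopologicalSpace α]
    [T2Space α] [OpensMeasurableSpace α] {μ : Measure α} [μ.OuterRegular]
    {f : (ℕ → ℕ) → α} (hf : Continuous f) {c : ℝ≥0∞} (hc : c < μ (range f)) :
    ∃ K : Set (ℕ → ℕ), IsCompact K ∧ c ≤ μ (f '' K) := by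
  have step : ∀ (k : ℕ) (P : Set (ℕ → ℕ)), ∃ m : ℕ, c < μ (f '' P) →
      c < μ (f '' (P ∩ {x | x k ≤ m})) := by
    intro k P
    by_cases hP : c < μ (f '' P)
    · have hmono : Monotone fun m : ℕ => f '' (P ∩ {x | x k ≤ m}) := fun a b hab =>
        image_mono (inter_subset_inter_right _ fun x (hx : x k ≤ a) => hx.trans hab)
      have hU : ⋃ m : ℕ, f '' (P ∩ {x | x k ≤ m}) = f '' P := by
        rw [← image_iUnion, ← inter_iUnion]
        congr 1
        exact inter_eq_left.2 fun x _ => mem_iUnion.2 ⟨x k, le_refl (x k)⟩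
      rw [← hU, hmono.measure_iUnion] at hP
      obtain ⟨m, hm⟩ := lt_iSup_iff.1 hP
      exact ⟨m, fun _ => hm⟩
    · exact ⟨0, fun h => absurd h hP⟩
  choose m hm using step
  let S : ℕ → Set (ℕ → ℕ) := fun n => Nat.rec univ (fun k P => P ∩ {x | x k ≤ m k P}) n
  let b : ℕ → ℕ := fun k => m k (S k)
  have hS_succ : ∀ k, S (k + 1) = S k ∩ {x | x k ≤ b k} := fun _ => rfl
  have hS : ∀ k, c < μ (f '' S k) := by
    intro k
    induction k with
    | zero => simpa [S] using hc
    | succ k ih => exact hm k (S k) ih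
  have hS_le : ∀ k, ∀ x ∈ S k, ∀ i < k, x i ≤ b i := by
    intro k
    induction k with
    | zero => intro x _ i hi; omega
    | succ k ih =>
      intro x hx i hi
      rw [hS_succ] at hx
      rcases Nat.lt_succ_iff_lt_or_eq.1 hi with h | rfl
      · exact ih x hx.1 i h
      · exact hx.2
  have hK : IsCompact (univ.pi fun i => Iic (b i)) :=
    isCompact_univ_pi fun i => (finite_Iic (b i)).isCompact
  refine ⟨_, hK, ?_⟩
  by_contra! hlt
  obtain ⟨U, hKU, hU, hUc⟩ := Set.exists_isOpen_lt_of_lt _ _ hlt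
  let : MetricSpace (ℕ → ℕ) := PiNat.metricSpaceNatNat
  obtain ⟨δ, hδ, hδU⟩ :=
    hK.exists_thickening_subset_open (hU.preimage hf) (image_subset_iff.1 hKU)
  obtain ⟨N, hN⟩ := exists_pow_lt_of_lt_one hδ (by norm_num : (1 / 2 : ℝ) < 1)
  refine (hS N).not_ge ((measure_mono (image_subset_iff.2 fun x hx => hδU ?_)).trans hUc.le)
  refine Metric.mem_thickening_iff.2 ⟨fun i => min (x i) (b i),
    fun i _ => mem_Iic.2 (min_le_right _ _), ?_⟩
  refine lt_of_le_of_lt ((PiNat.mem_cylinder_iff_dist_le (E := fun _ => ℕ)).1 ?_) hN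
  intro i hi
  exact (min_eq_left (hS_le N x hx i hi)).symm

/-- Analytic sets are universally measurable. -/
theorem MeasureTheory.AnalyticSet.nullMeasurableSet {α : Type*} [MeasurableSpace α]
    [TopologicalSpace α] [T2Space α] [OpensMeasurableSpace α] {s : Set α} (hs : AnalyticSet s)
    (μ : Measure α) [IsFiniteMeasure μ] [μ.OuterRegular] : NullMeasurableSet s μ := by
  rw [AnalyticSet] at hs
  rcases hs with rfl | ⟨f, hf, rfl⟩
  · exact nullMeasurableSet_empty
  rcases eq_zero_or_pos (μ (range f)) with h0 | hpos
  · exact NullMeasurableSet.of_null h0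
  obtain ⟨c, -, hc, hlim⟩ := exists_seq_strictMono_tendsto' hpos
  choose K hK hcK using fun n => exists_isCompact_le_measure_image hf (hc n).2
  have hmeas : MeasurableSet (⋃ n, f '' K n) :=
    MeasurableSet.iUnion fun n => ((hK n).image hf).isClosed.measurableSet
  have hsub : (⋃ n, f '' K n) ⊆ range f := iUnion_subset fun n => image_subset_range _ _
  have hle : μ (range f) ≤ μ (⋃ n, f '' K n) :=
    le_of_tendsto' hlim fun n => (hcK n).trans (measure_mono (subset_iUnion (fun n => f '' K n) n))
  exact hmeas.nullMeasurableSet.congr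
    (ae_eq_of_subset_of_measure_ge hsub hle hmeas.nullMeasurableSet (measure_ne_top _ _))

theorem suppFun2_eq_suppFun {U Z : Type*} {d : ℕ} (G : Set (U × Z))
    (ρ : U → Z → EuclideanSpace ℝ (Fin d))
    (l : EuclideanSpace ℝ (Fin d)) : suppFun2 G ρ l = suppFun G ρ l := by
  funext z
  simp only [suppFun2, suppFun, momentSet, image_image]

theorem le_suppFun {U Z : Type*} {d : ℕ} {G : Set (U × Z)}
    (ρ : U → Z → EuclideanSpace ℝ (Fin d))
    (l : EuclideanSpace ℝ (Fin d)) {p : U × Z} (hp : p ∈ G) :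
    ((⟪l, ρ p.1 p.2⟫ : ℝ) : EReal) ≤ suppFun G ρ l p.2 :=
  le_sSup ⟨_, ⟨p.1, hp, rfl⟩, rfl⟩

theorem aemeasurable_suppFun {d : ℕ} {G : Set (𝓤 × 𝓩)} (hG : MeasurableSet G)
    {ρ : 𝓤 → 𝓩 → EuclideanSpace ℝ (Fin d)} (hρ : Measurable fun p : 𝓤 × 𝓩 => ρ p.1 p.2)
    (l : EuclideanSpace ℝ (Fin d)) (F : Measure 𝓩) [IsFiniteMeasure F] :
    AEMeasurable (suppFun G ρ l) F := by
  refine NullMeasurable.aemeasurable ?_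
  refine measurable_of_Ioi (δ := NullMeasurableSpace 𝓩 F) fun c => ?_
  have hpre : suppFun G ρ l ⁻¹' Ioi c =
      Prod.snd '' (G ∩ {p : 𝓤 × 𝓩 | c < ((⟪l, ρ p.1 p.2⟫ : ℝ) : EReal)}) := by
    ext z
    simp only [suppFun, momentSet, sectionSet, mem_preimage, mem_Ioi, lt_sSup_iff, mem_image,
      mem_inter_iff, Prod.exists, exists_eq_right]
    constructor
    · rintro ⟨_, ⟨_, ⟨u, hu, rfl⟩, rfl⟩, hc⟩
      exact ⟨u, hu, hc⟩
    · rintro ⟨u, hu, hc⟩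
      exact ⟨_, ⟨_, ⟨u, hu, rfl⟩, rfl⟩, hc⟩
  have hmeas : MeasurableSet (G ∩ {p : 𝓤 × 𝓩 | c < ((⟪l, ρ p.1 p.2⟫ : ℝ) : EReal)}) :=
    hG.inter (measurableSet_lt measurable_const (hρ.const_inner).coe_real_ereal)
  have hnull : NullMeasurableSet (suppFun G ρ l ⁻¹' Ioi c) F := by
    rw [hpre]
    exact (hmeas.analyticSet.image_of_continuous continuous_snd).nullMeasurableSet F
  exact hnull

theorem EReal.measurable_posPart : Measurable EReal.posPart :=
  Measurable.ite (measurableSet_singleton ⊤) measurable_const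
    (measurable_ereal_toReal.ennreal_ofReal)

theorem EReal.posPart_coe (x : ℝ) : EReal.posPart (x : EReal) = ENNReal.ofReal x := by
  simp [EReal.posPart]

theorem EReal.posPart_mono {x y : EReal} (h : x ≤ y) : x.posPart ≤ y.posPart := by
  induction x <;> induction y <;> simp_all [EReal.posPart, ENNReal.ofReal_le_ofReal]

theorem EReal.eq_of_posPart_eq {x y : EReal} (h : x.posPart = y.posPart)
    (h' : (-x).posPart = (-y).posPart) : x = y := by
  have key (a : ℝ) : (ENNReal.ofReal a).toReal - (ENNReal.ofReal (-a)).toReal = a := by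
    rw [ENNReal.toReal_ofReal', ENNReal.toReal_ofReal', max_zero_sub_max_neg_zero_eq_self]
  induction x <;> induction y <;>
    simp_all [EReal.posPart, ← EReal.coe_neg, -ENNReal.ofReal_eq_ofReal_iff]
  rename_i a b
  rw [← key a, h, h', key b]

section MeanZero

variable {Ω : Type*} [MeasurableSpace Ω] {H : Measure Ω}

theorem lintegral_posPart_eq_of_integral_eq_zero {q : Ω → ℝ} (hq : Integrable q H)
    (hq0 : ∫ p, q p ∂H = 0) :
    ∫⁻ p, ENNReal.ofReal (q p) ∂H = ∫⁻ p, ENNReal.ofReal (-q p) ∂H := by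
  rw [integral_eq_lintegral_pos_part_sub_lintegral_neg_part hq, sub_eq_zero] at hq0
  exact (ENNReal.toReal_eq_toReal_iff' hq.lintegral_lt_top.ne hq.neg.lintegral_lt_top.ne).1 hq0

theorem integralEReal_nonneg_of_ae_le {q : Ω → ℝ} (hq : Integrable q H)
    (hq0 : ∫ p, q p ∂H = 0) {G : Ω → EReal} (hle : ∀ᵐ p ∂H, (q p : EReal) ≤ G p) :
    0 ≤ integralEReal H G := by
  have hP : ∫⁻ p, ENNReal.ofReal (q p) ∂H ≤ ∫⁻ p, (G p).posPart ∂H :=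
    lintegral_mono_ae <| hle.mono fun p hp => by
      simpa [EReal.posPart_coe] using EReal.posPart_mono hp
  have hN : ∫⁻ p, (-(G p)).posPart ∂H ≤ ∫⁻ p, ENNReal.ofReal (-q p) ∂H :=
    lintegral_mono_ae <| hle.mono fun p hp => by
      simpa [← EReal.coe_neg, EReal.posPart_coe] using
        EReal.posPart_mono (EReal.neg_le_neg_iff.2 hp)
  have htop := (hN.trans_lt hq.neg.lintegral_lt_top).ne
  rw [← lintegral_posPart_eq_of_integral_eq_zero hq hq0] at hN
  rw [integralEReal, EReal.sub_nonneg (by simp [htop]) (by simp)]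
  exact_mod_cast hN.trans hP

theorem ae_eq_of_ae_le_of_integralEReal_eq_zero {q : Ω → ℝ} (hq : Integrable q H)
    (hq0 : ∫ p, q p ∂H = 0) {G : Ω → EReal} (hG : AEMeasurable G H)
    (hle : ∀ᵐ p ∂H, (q p : EReal) ≤ G p) (hG0 : integralEReal H G = 0) :
    ∀ᵐ p ∂H, (q p : EReal) = G p := by
  have hpos : ∀ᵐ p ∂H, ENNReal.ofReal (q p) ≤ (G p).posPart := hle.mono fun p hp => by
    simpa [EReal.posPart_coe] using EReal.posPart_mono hp
  have hneg : ∀ᵐ p ∂H, (-(G p)).posPart ≤ ENNReal.ofReal (-q p) := hle.mono fun p hp => by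
    simpa [← EReal.coe_neg, EReal.posPart_coe] using
      EReal.posPart_mono (EReal.neg_le_neg_iff.2 hp)
  have hP := lintegral_mono_ae hpos
  have hN := lintegral_mono_ae hneg
  have hfin := hq.neg.lintegral_lt_top
  have htop := (hN.trans_lt hfin).ne
  have hB := lintegral_posPart_eq_of_integral_eq_zero hq hq0
  have hPN : ∫⁻ p, (G p).posPart ∂H ≤ ∫⁻ p, (-(G p)).posPart ∂H := by
    have h := hG0.le
    rw [integralEReal, EReal.sub_nonpos] at h
    exact_mod_cast h
  have e1 := ae_eq_of_ae_le_of_lintegral_le hpos (hB ▸ hfin.ne)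
    (EReal.measurable_posPart.comp_aemeasurable hG) (hPN.trans (hN.trans hB.ge))
  have e2 := ae_eq_of_ae_le_of_lintegral_le hneg htop
    hq.aemeasurable.neg.ennreal_ofReal (hB.ge.trans (hP.trans hPN))
  filter_upwards [e1, e2] with p h₁ h₂
  refine EReal.eq_of_posPart_eq ?_ ?_
  · rw [EReal.posPart_coe, h₁]
  · rw [← EReal.coe_neg, EReal.posPart_coe, ← h₂]

/-- A random vector is integrable with mean zero. -/
def MeanZero {E : Type*} [NormedAddCommGroup E] [NormedSpace ℝ E] (f : Ω → E) (H : Measure Ω) :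
    Prop :=
  Integrable f H ∧ ∫ p, f p ∂H = 0

theorem MeanZero.congr {E : Type*} [NormedAddCommGroup E] [NormedSpace ℝ E] {f g : Ω → E}
    (hf : MeanZero f H) (h : f =ᵐ[H] g) : MeanZero g H :=
  ⟨hf.1.congr h, by rw [← integral_congr_ae h, hf.2]⟩

theorem meanZero_iff_forall_apply {n : ℕ} {f : Ω → EuclideanSpace ℝ (Fin n)} :
    MeanZero f H ↔ ∀ i, MeanZero (fun p => f p i) H := by
  refine ⟨fun h i => ⟨h.1.eval_piLp i, ?_⟩, fun h => ⟨.of_eval_piLp fun i => (h i).1, ?_⟩⟩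
  · rw [← eval_integral_piLp h.1.eval_piLp i, h.2]
    rfl
  · ext i
    rw [eval_integral_piLp (fun i => (h i).1) i, (h i).2]
    rfl

theorem MeanZero.const_inner {n : ℕ} {f : Ω → EuclideanSpace ℝ (Fin n)} (hf : MeanZero f H)
    (l : EuclideanSpace ℝ (Fin n)) : MeanZero (fun p => (⟪l, f p⟫ : ℝ)) H :=
  ⟨hf.1.const_inner l, by rw [integral_inner hf.1, hf.2, inner_zero_right]⟩

/-- A random vector has mean zero as soon as its components along a basis do. -/
theorem meanZero_of_inner_linearIndependent {n : ℕ} {f : Ω → EuclideanSpace ℝ (Fin n)}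
    {v : Fin n → EuclideanSpace ℝ (Fin n)} (hv : LinearIndependent ℝ v)
    (h : ∀ i, MeanZero (fun p => (⟪v i, f p⟫ : ℝ)) H) : MeanZero f H := by
  have hall : ∀ l, MeanZero (fun p => (⟪l, f p⟫ : ℝ)) H := by
    intro l
    have hl : l ∈ Submodule.span ℝ (range v) := by
      rw [hv.span_eq_top_of_card_eq_finrank' (by simp)]
      trivial
    induction hl using Submodule.span_induction with
    | mem x hx =>
      obtain ⟨i, rfl⟩ := hx
      exact h i
    | zero => simp [MeanZero]
    | add x y _ _ hx hy =>
      simp only [MeanZero, inner_add_left]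
      exact ⟨hx.1.add hy.1, by rw [integral_add hx.1 hy.1, hx.2, hy.2, add_zero]⟩
    | smul a x _ hx =>
      simp only [MeanZero, real_inner_smul_left]
      exact ⟨hx.1.const_mul a, by rw [integral_const_mul, hx.2, mul_zero]⟩
  refine meanZero_iff_forall_apply.2 fun i => ?_
  simpa [EuclideanSpace.inner_single_left] using hall (EuclideanSpace.single i 1)

end MeanZero

theorem integralEReal_map {Ω Z : Type*} [MeasurableSpace Ω] [MeasurableSpace Z] {H : Measure Ω}
    {φ : Ω → Z}
    (hφ : Measurable φ) {g : Z → EReal} (hg : AEMeasurable g (H.map φ)) :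
    integralEReal (H.map φ) g = integralEReal H fun p => g (φ p) := by
  have hpos := lintegral_map' (EReal.measurable_posPart.comp_aemeasurable hg) hφ.aemeasurable
  have hneg := lintegral_map' (EReal.measurable_posPart.comp_aemeasurable hg.neg) hφ.aemeasurable
  simp only [Function.comp_apply, Pi.neg_apply] at hpos hneg
  rw [integralEReal, integralEReal, hpos, hneg]

theorem memSFSet_map_snd {d : ℕ} {G : Set (𝓤 × 𝓩)} (hG : MeasurableSet G)
    {ρ : 𝓤 → 𝓩 → EuclideanSpace ℝ (Fin d)} (hρ : Measurable fun p : 𝓤 × 𝓩 => ρ p.1 p.2)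
    {H : Measure (𝓤 × 𝓩)} [IsFiniteMeasure H] (hHG : ∀ᵐ p ∂H, p ∈ G)
    (h : MeanZero (fun p : 𝓤 × 𝓩 => ρ p.1 p.2) H) : MemSFSet G ρ (H.map Prod.snd) := by
  intro l _
  rw [integralEReal_map measurable_snd (aemeasurable_suppFun hG hρ l _)]
  exact integralEReal_nonneg_of_ae_le (h.const_inner l).1 (h.const_inner l).2
    (hHG.mono fun p hp => le_suppFun ρ l hp)

theorem meanZero_rComb_iff {U Z : Type*} [MeasurableSpace U] [MeasurableSpace Z]
    {d1 d2 : ℕ} {ρ₁ : Z → EuclideanSpace ℝ (Fin d1)}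
    {ρ₂ : U → Z → EuclideanSpace ℝ (Fin d2)} {H : Measure (U × Z)} :
    MeanZero (fun p : U × Z => rComb ρ₁ ρ₂ p.1 p.2) H ↔
      MeanZero (fun p : U × Z => ρ₁ p.2) H ∧ MeanZero (fun p : U × Z => ρ₂ p.1 p.2) H := by
  simp [meanZero_iff_forall_apply, Fin.forall_fin_add, rComb]

theorem meanZero_redR_iff {U Z : Type*} [MeasurableSpace U] [MeasurableSpace Z]
    {d1 d2 : ℕ} {G : Set (U × Z)} {ρ₁ : Z → EuclideanSpace ℝ (Fin d1)}
    {ρ₂ : U → Z → EuclideanSpace ℝ (Fin d2)} {hd2 : 0 < d2}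
    {lam : Fin d2 → EuclideanSpace ℝ (Fin d2)} (hli : LinearIndependent ℝ lam)
    {H : Measure (U × Z)} (hmax : ∀ᵐ p ∂H, ((⟪lam ⟨0, hd2⟩, ρ₂ p.1 p.2⟫ : ℝ) : EReal) =
      suppFun2 G ρ₂ (lam ⟨0, hd2⟩) p.2) :
    MeanZero (fun p : U × Z => redR G ρ₁ ρ₂ hd2 lam p.1 p.2) H ↔
      MeanZero (fun p : U × Z => ρ₁ p.2) H ∧ MeanZero (fun p : U × Z => ρ₂ p.1 p.2) H := by
  have hred : ∀ i, (fun p : U × Z => if (i : Fin d2).1 = 0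
      then (suppFun2 G ρ₂ (lam ⟨0, hd2⟩) p.2).toReal else (⟪lam i, ρ₂ p.1 p.2⟫ : ℝ)) =ᵐ[H]
        fun p => ⟪lam i, ρ₂ p.1 p.2⟫ := by
    intro i
    filter_upwards [hmax] with p hp
    split_ifs with hi
    · rw [← hp, EReal.toReal_coe, show i = ⟨0, hd2⟩ from Fin.ext hi]
    · rfl
  have hiff : MeanZero (fun p : U × Z => ρ₂ p.1 p.2) H ↔
      ∀ i, MeanZero (fun p : U × Z => if (i : Fin d2).1 = 0
        then (suppFun2 G ρ₂ (lam ⟨0, hd2⟩) p.2).toReal else (⟪lam i, ρ₂ p.1 p.2⟫ : ℝ)) H :=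
    ⟨fun h i => (h.const_inner (lam i)).congr (hred i).symm,
      fun h => meanZero_of_inner_linearIndependent hli fun i => (h i).congr (hred i)⟩
  rw [hiff, meanZero_iff_forall_apply, meanZero_iff_forall_apply, Fin.forall_fin_add]
  simp [redR]

/-- **Theorem B.2, part 2 (reducibility under failure of the interior condition).**
Suppose Assumption 1 holds, `𝓕` is convex, and `r₁(·;θ)` is `F`-integrable for every `F ∈ 𝓕`.
Fix `θ ∈ Θ`, suppose `𝓕'_θ` is nonempty, and that there is no `F ∈ 𝓕` with
`∫ r₁(z;θ) dF = 0` and `inf_{λ ∈ 𝒮₂} ∫ γ₂(λ,z;θ) dF > 0`.  Let `λ̃ ∈ 𝒮₂` satisfy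
`∫ γ₂(λ̃,z;θ) dF = 0` for every `F ∈ 𝓕'_θ`.  Then for any vectors `λ₂, …, λ_{dim r₂}` making
`λ̃, λ₂, …, λ_{dim r₂}` linearly independent, the reduced model `(Γ̃, r̃)` built from them has,
for every `F ∈ 𝓕`, the same identified set membership at `θ` as `(Γ, r)`.
In particular, the model `(Γ, r)` is reducible at `θ`. -/
theorem reducible_of_no_interior_distribution {d1 d2 : ℕ}
    (𝓕 : Set (Measure 𝓩)) (hprob : ∀ F ∈ 𝓕, IsProbabilityMeasure F)
    (hconv : ConvexFamily 𝓕)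
    (Γ : Θ → Set (𝓤 × 𝓩)) (r1 : Θ → 𝓩 → EuclideanSpace ℝ (Fin d1))
    (r2 : Θ → 𝓤 → 𝓩 → EuclideanSpace ℝ (Fin d2))
    (h1 : Assumption1 𝓕 Γ (fun θ => rComb (r1 θ) (r2 θ)))
    (hr1int : ∀ F ∈ 𝓕, ∀ θ : Θ, Integrable (r1 θ) F)
    (θ : Θ)
    (hne : ({F ∈ 𝓕 | MemSFSet (Γ θ) (rComb (r1 θ) (r2 θ)) F}).Nonempty)
    (hno : ¬ ∃ F ∈ 𝓕, (∫ z, r1 θ z ∂F) = 0 ∧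
      (0 : EReal) < ⨅ l : {l : EuclideanSpace ℝ (Fin d2) // ‖l‖ = 1},
        integralEReal F (suppFun2 (Γ θ) (r2 θ) l.1))
    (hd2 : 0 < d2) (lt : EuclideanSpace ℝ (Fin d2)) (hlt : ‖lt‖ = 1)
    (hdeg : ∀ F ∈ 𝓕, MemSFSet (Γ θ) (rComb (r1 θ) (r2 θ)) F →
      integralEReal F (suppFun2 (Γ θ) (r2 θ) lt) = 0)
    (lam : Fin d2 → EuclideanSpace ℝ (Fin d2)) (hlam0 : lam ⟨0, hd2⟩ = lt)
    (hli : LinearIndependent ℝ lam) :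
    ∀ F ∈ 𝓕, (MemIdentified (Γ θ) (rComb (r1 θ) (r2 θ)) F ↔
      MemIdentified (redGamma (Γ θ) (r2 θ) lt) (redR (Γ θ) (r1 θ) (r2 θ) hd2 lam) F) := by
  subst hlam0
  intro F hF
  have := hprob F hF
  have hA := h1 θ F hF
  have hG := hA.borel_Gamma
  have hr := hA.measurable_r
  have hr2 : Measurable fun p : 𝓤 × 𝓩 => r2 θ p.1 p.2 := by
    refine (EuclideanSpace.equiv (Fin d2) ℝ).toHomeomorph.measurableEmbedding.measurable_comp_iff.1
      (measurable_pi_lambda _ fun i => ?_)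
    simpa [rComb, Function.comp_def] using
      (EuclideanSpace.proj (𝕜 := ℝ) (Fin.natAdd d1 i)).measurable.comp hr
  have hγ (l) : AEMeasurable (suppFun2 (Γ θ) (r2 θ) l) F := by
    rw [suppFun2_eq_suppFun]
    exact aemeasurable_suppFun hG hr2 l F
  constructor
  · rintro ⟨H, hH, hHG, rfl, hint, hzero⟩
    have hae : ∀ᵐ p ∂H, p ∈ Γ θ := (mem_ae_iff_prob_eq_one hG).2 hHG
    have hmz : MeanZero _ H := ⟨hint, hzero⟩
    have hmz2 := meanZero_rComb_iff.1 hmz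
    have hdeg0 := hdeg _ hF (memSFSet_map_snd hG hr hae hmz)
    rw [integralEReal_map measurable_snd (hγ _)] at hdeg0
    have hmax := ae_eq_of_ae_le_of_integralEReal_eq_zero (hmz2.2.const_inner _).1
      (hmz2.2.const_inner _).2 ((hγ _).comp_measurable measurable_snd)
      (hae.mono fun p hp => by
        simpa only [suppFun2_eq_suppFun, Function.comp] using le_suppFun (r2 θ) (lam ⟨0, hd2⟩) hp)
      hdeg0
    have hred := (meanZero_redR_iff (G := Γ θ) hli hmax).2 hmz2
    refine ⟨H, hH, ?_, rfl, hred.1, hred.2⟩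
    refine (measure_congr (Filter.eventuallyEq_univ.2 ?_)).trans measure_univ
    filter_upwards [hae, hmax] with p hp hpmax using ⟨hp, hpmax⟩
  · rintro ⟨H, hH, hHG, rfl, hint, hzero⟩
    have hset : NullMeasurableSet (redGamma (Γ θ) (r2 θ) (lam ⟨0, hd2⟩)) H :=
      hG.nullMeasurableSet.inter (nullMeasurableSet_eq_fun
        (hr2.const_inner).coe_real_ereal.aemeasurable
        ((hγ _).comp_measurable measurable_snd))
    have hae : ∀ᵐ p ∂H, p ∈ redGamma (Γ θ) (r2 θ) (lam ⟨0, hd2⟩) :=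
      (mem_ae_iff_prob_eq_one₀ hset).2 hHG
    have hmz := meanZero_rComb_iff.2
      ((meanZero_redR_iff (G := Γ θ) hli (hae.mono fun p hp => hp.2)).1 ⟨hint, hzero⟩)
    refine ⟨H, hH, le_antisymm prob_le_one ?_, rfl, hmz.1, hmz.2⟩
    exact hHG.ge.trans (measure_mono fun p hp => hp.1)

end
end

section
/- Sufficient condition for membership in the identified set (Lemma C.1, part i). Suppose Assumption 1 holds, F ∈ 𝓕, θ ∈ Θ, and r₁(·;θ) is F-integrable. If ∫ r₁(z;θ) dF = 0 and inf_{λ ∈ 𝒮₂} ∫ γ₂(λ,z;θ) dF > 0 (including the case where this infimum equals +∞, in particular when dim r₂ = 0), then θ ∈ Θ_I(F). -/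
open MeasureTheory Set
open scoped ENNReal RealInnerProductSpace

noncomputable section

variable {𝓤 𝓩 : Type*}
  [MeasurableSpace 𝓤] [TopologicalSpace 𝓤] [PolishSpace 𝓤] [BorelSpace 𝓤]
  [MeasurableSpace 𝓩] [TopologicalSpace 𝓩] [PolishSpace 𝓩] [BorelSpace 𝓩]
  {Θ : Type*}

/-- A continuous map on a compact metrizable space admits a Borel measurable section over its
range. -/
theorem exists_measurable_section_of_compact {X Y : Type*} [TopologicalSpace X] [CompactSpace X]
    [TopologicalSpace.MetrizableSpace X] [MeasurableSpace X] [BorelSpace X] [Nonempty X]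
    [TopologicalSpace Y] [T2Space Y] [MeasurableSpace Y] [BorelSpace Y] {f : X → Y}
    (hf : Continuous f) :
    ∃ s : Y → X, Measurable s ∧ ∀ y ∈ range f, f (s y) = y := by
  let _ := TopologicalSpace.metrizableSpaceMetric X
  obtain ⟨c, hc, hcs⟩ := exists_nat_bool_continuous_surjective_of_compact X
  obtain ⟨p, hp, hps⟩ : ∃ p : cantorSet → X, Continuous p ∧ Function.Surjective p :=
    ⟨c ∘ cantorSetHomeomorphNatToBool, hc.comp cantorSetHomeomorphNatToBool.continuous,
      hcs.comp cantorSetHomeomorphNatToBool.surjective⟩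
  have : CompactSpace cantorSet := isCompact_iff_compactSpace.1 isCompact_cantorSet
  have hq : Continuous (f ∘ p) := hf.comp hp
  let fib : Y → Set ℝ := fun y => Subtype.val '' ((f ∘ p) ⁻¹' {y})
  have hfib : ∀ y, IsCompact (fib y) := fun y =>
    (isClosed_singleton.preimage hq).isCompact.image continuous_subtype_val
  have hne : ∀ y, y ∈ range f → (fib y).Nonempty := by
    rintro y ⟨x, rfl⟩
    obtain ⟨a, rfl⟩ := hps x
    exact ⟨a, a, rfl, rfl⟩
  have hempty : ∀ y, y ∉ range f → fib y = ∅ := by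
    intro y hy
    rw [eq_empty_iff_forall_notMem]
    rintro _ ⟨a, ha, rfl⟩
    exact hy ⟨p a, ha⟩
  have hinf : ∀ y, y ∈ range f → sInf (fib y) ∈ fib y := fun y hy => (hfib y).sInf_mem (hne y hy)
  have hmem : ∀ y, sInf (fib y) ∈ cantorSet := by
    intro y
    by_cases hy : y ∈ range f
    · obtain ⟨a, -, ha⟩ := hinf y hy
      rw [← ha]
      exact a.2
    · rw [hempty y hy, Real.sInf_empty]
      exact zero_mem_cantorSet
  have hrange : MeasurableSet (range f) := (isCompact_range hf).isClosed.measurableSet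
  have hmeas : Measurable fun y => sInf (fib y) := by
    refine measurable_of_Iic fun t => ?_
    have key : (fun y => sInf (fib y)) ⁻¹' Iic t =
        (f ∘ p) '' {a | (a : ℝ) ≤ t} ∪ ((range f)ᶜ ∩ {_y | (0 : ℝ) ≤ t}) := by
      ext y
      simp only [mem_preimage, mem_Iic, mem_union, mem_inter_iff, mem_compl_iff, mem_ofPred_eq]
      constructor
      · intro h
        by_cases hy : y ∈ range f
        · obtain ⟨a, ha, hat⟩ := hinf y hy
          exact Or.inl ⟨a, by simpa [hat] using h, ha⟩
        · rw [hempty y hy, Real.sInf_empty] at h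
          exact Or.inr ⟨hy, h⟩
      · rintro (⟨a, ha, rfl⟩ | ⟨hy, ht⟩)
        · exact (csInf_le (hfib _).bddBelow ⟨a, rfl, rfl⟩).trans ha
        · rwa [hempty y hy, Real.sInf_empty]
    rw [key]
    refine MeasurableSet.union ?_ (hrange.compl.inter (MeasurableSet.const _))
    exact ((isClosed_Iic.preimage continuous_subtype_val).isCompact.image hq).isClosed.measurableSet
  refine ⟨fun y => p ⟨sInf (fib y), hmem y⟩, hp.measurable.comp (hmeas.subtype_mk), ?_⟩
  intro y hy
  obtain ⟨a, ha, hat⟩ := hinf y hy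
  have : (⟨sInf (fib y), hmem y⟩ : cantorSet) = a := Subtype.ext hat.symm
  simp only [this]
  exact ha

/-- Boxes in the Baire space are compact. -/
theorem isCompact_setOf_forall_le (n : ℕ → ℕ) : IsCompact {x : ℕ → ℕ | ∀ i, x i ≤ n i} := by
  have : {x : ℕ → ℕ | ∀ i, x i ≤ n i} = Set.pi univ fun i => Iic (n i) := by
    ext x
    exact ⟨fun h i _ => h i, fun h i => h i (mem_univ i)⟩
  rw [this]
  exact isCompact_univ_pi fun i => (finite_Iic (n i)).isCompact

/-- An open set containing a box of sequences contains a cylinder over a finite-dimensional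
projection of the box. -/
theorem exists_cylinder_subset_of_isOpen {n : ℕ → ℕ} {V : Set (ℕ → ℕ)} (hV : IsOpen V)
    (h : {x : ℕ → ℕ | ∀ i, x i ≤ n i} ⊆ V) : ∃ k, {x : ℕ → ℕ | ∀ i < k, x i ≤ n i} ⊆ V := by
  by_contra! hcon
  simp only [not_subset] at hcon
  choose x hx hxV using hcon
  have hK := isCompact_setOf_forall_le n
  obtain ⟨a, ha, φ, hφ, hlim⟩ := hK.tendsto_subseq (x := fun k i => min (x k i) (n i))
    (fun k i => min_le_right _ _)
  have hlim' : Filter.Tendsto (fun k => x (φ k)) Filter.atTop (nhds a) := by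
    rw [tendsto_pi_nhds] at hlim ⊢
    intro i
    refine (hlim i).congr' ?_
    filter_upwards [Filter.eventually_gt_atTop i] with k hk
    exact min_eq_left (hx (φ k) i (hk.trans_le (hφ.id_le k)))
  obtain ⟨k, hk⟩ := (hlim'.eventually (hV.mem_nhds (h ha))).exists
  exact hxV _ hk

/-- Inner approximation of the (outer) measure of a continuous image of the Baire space by
images of compact boxes. -/
theorem exists_box_le_measure_image {Y : Type*} [TopologicalSpace Y] [MeasurableSpace Y]
    {μ : Measure Y} [μ.OuterRegular] {f : (ℕ → ℕ) → Y} (hf : Continuous f) {c : ℝ≥0∞}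
    (hc : c < μ (range f)) : ∃ n : ℕ → ℕ, c ≤ μ (f '' {x | ∀ i, x i ≤ n i}) := by
  have step : ∀ (k : ℕ) (A : Set (ℕ → ℕ)), c < μ (f '' A) →
      ∃ m, c < μ (f '' (A ∩ {x | x k ≤ m})) := by
    intro k A hA
    have hmono : Monotone fun m => f '' (A ∩ {x | x k ≤ m}) := fun a b hab =>
      image_mono (inter_subset_inter_right _ fun x (hx : x k ≤ a) => hx.trans hab)
    have hU : ⋃ m, f '' (A ∩ {x | x k ≤ m}) = f '' A := by
      rw [← image_iUnion, ← inter_iUnion]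
      congr 1
      exact inter_eq_left.2 fun x _ => mem_iUnion.2 ⟨x k, le_refl (x k)⟩
    rw [← hU, hmono.measure_iUnion, lt_iSup_iff] at hA
    exact hA
  choose! m hm using step
  let A : ℕ → Set (ℕ → ℕ) := fun k => Nat.rec univ (fun k A => A ∩ {x | x k ≤ m k A}) k
  have hA : ∀ k, c < μ (f '' A k) := by
    intro k
    induction k with
    | zero => simpa [A] using hc
    | succ k ih => exact hm k _ ih
  have hA' : ∀ k, {x : ℕ → ℕ | ∀ i < k, x i ≤ m i (A i)} = A k := by
    intro k
    induction k with
    | zero => simp [A]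
    | succ k ih =>
      change _ = A k ∩ {x | x k ≤ m k (A k)}
      ext x
      have ihx := Set.ext_iff.1 ih x
      simp only [mem_ofPred_eq, mem_inter_iff, Nat.lt_succ_iff_lt_or_eq] at ihx ⊢
      rw [← ihx]
      constructor
      · exact fun h => ⟨fun i hi => h i (Or.inl hi), h k (Or.inr rfl)⟩
      · rintro ⟨h, h'⟩ i (hi | rfl)
        exacts [h i hi, h']
  refine ⟨fun i => m i (A i), le_of_not_gt fun hlt => ?_⟩
  obtain ⟨U, hU, hUo, hUc⟩ := Set.exists_isOpen_lt_of_lt _ c hlt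
  obtain ⟨k, hk⟩ := exists_cylinder_subset_of_isOpen (hUo.preimage hf) (image_subset_iff.1 hU)
  rw [hA'] at hk
  exact (hA k).not_ge ((measure_mono (image_subset_iff.2 hk)).trans hUc.le)

/-- **Measurable selection**, continuous case. -/
theorem exists_measurable_section_of_continuous_baire {Y : Type*} [TopologicalSpace Y]
    [PolishSpace Y] [MeasurableSpace Y] [BorelSpace Y] (μ : Measure Y) [IsFiniteMeasure μ]
    {f : (ℕ → ℕ) → Y} (hf : Continuous f) :
    ∃ (B : Set Y) (s : Y → ℕ → ℕ), MeasurableSet B ∧ B ⊆ range f ∧ μ (range f) ≤ μ B ∧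
      Measurable s ∧ ∀ y ∈ B, f (s y) = y := by
  have box : ∀ n : ℕ → ℕ, ∃ s : Y → ℕ → ℕ, Measurable s ∧
      MeasurableSet (f '' {x | ∀ i, x i ≤ n i}) ∧
      ∀ y ∈ f '' {x | ∀ i, x i ≤ n i}, f (s y) = y := by
    intro n
    have hK := isCompact_setOf_forall_le n
    have := isCompact_iff_compactSpace.1 hK
    have : Nonempty {x : ℕ → ℕ | ∀ i, x i ≤ n i} := ⟨⟨n, fun i => le_rfl⟩⟩
    obtain ⟨s, hs, hs'⟩ := exists_measurable_section_of_compact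
      (f := fun x : {x : ℕ → ℕ | ∀ i, x i ≤ n i} => f x) (hf.comp continuous_subtype_val)
    refine ⟨fun y => s y, hs.subtype_val, (hK.image hf).isClosed.measurableSet, ?_⟩
    rintro y ⟨x, hx, rfl⟩
    exact hs' _ ⟨⟨x, hx⟩, rfl⟩
  choose s hs hK hfs using box
  by_cases h0 : μ (range f) = 0
  · exact ⟨∅, s 0, MeasurableSet.empty, empty_subset _, by simp [h0], hs 0, by simp⟩
  obtain ⟨c, -, hc, hclim⟩ := exists_seq_strictMono_tendsto' (pos_iff_ne_zero.2 h0)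
  choose n hn using fun j => exists_box_le_measure_image hf (hc j).2
  set B : Set Y := ⋃ j, f '' {x | ∀ i, x i ≤ n j i} with hBdef
  have hB : MeasurableSet B := MeasurableSet.iUnion fun j => hK (n j)
  classical
  have hex : ∀ y, ∃ j, y ∈ f '' {x | ∀ i, x i ≤ n j i} ∨ y ∉ B := by
    intro y
    by_cases hy : y ∈ B
    · obtain ⟨j, hj⟩ := mem_iUnion.1 hy
      exact ⟨j, Or.inl hj⟩
    · exact ⟨0, Or.inr hy⟩
  refine ⟨B, fun y => s (n (Nat.find (hex y))) y, hB,
    iUnion_subset fun j => image_subset_range _ _, ?_, ?_, ?_⟩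
  · exact le_of_tendsto' hclim fun j =>
      (hn j).trans (measure_mono (subset_iUnion (fun j => f '' {x | ∀ i, x i ≤ n j i}) j))
  · exact Measurable.find (f := fun j y => s (n j) y)
      (p := fun j y => y ∈ f '' {x | ∀ i, x i ≤ n j i} ∨ y ∉ B) (fun j => hs _)
      (fun j => (hK (n j)).union hB.compl) hex
  · intro y hy
    exact hfs _ _ ((Nat.find_spec (hex y)).resolve_right (not_not.2 hy))

/-- **Measurable selection** (Jankov–von Neumann): a Borel map between standard Borel spaces has,
for every finite measure on the target, a measurable section on a Borel subset of its range
carrying the full outer measure of the range. -/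
theorem Measurable.exists_measurable_section {X Y : Type*} [MeasurableSpace X]
    [StandardBorelSpace X] [Nonempty X] [MeasurableSpace Y] [StandardBorelSpace Y]
    (μ : Measure Y) [IsFiniteMeasure μ] {f : X → Y} (hf : Measurable f) :
    ∃ (B : Set Y) (s : Y → X), MeasurableSet B ∧ B ⊆ range f ∧ B =ᵐ[μ] range f ∧
      Measurable s ∧ ∀ y ∈ B, f (s y) = y := by
  let _ := upgradeStandardBorel X
  let _ := upgradeStandardBorel Y
  obtain ⟨e, he, hes, hfe⟩ : ∃ e : (ℕ → ℕ) → X,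
      Continuous e ∧ Function.Surjective e ∧ Continuous (f ∘ e) := by
    obtain ⟨t', ht', hft', hpol⟩ := hf.exists_continuous
    obtain ⟨e, he, hes⟩ := @PolishSpace.exists_nat_nat_continuous_surjective X t' hpol _
    exact ⟨e, continuous_iff_coinduced_le.2 ((continuous_iff_coinduced_le.1 he).trans ht'), hes,
      hft'.comp he⟩
  obtain ⟨B, s, hB, hBr, hle, hs, hsf⟩ := exists_measurable_section_of_continuous_baire μ hfe
  rw [hes.range_comp] at hBr hle
  exact ⟨B, fun y => e (s y), hB, hBr,
    ae_eq_of_subset_of_measure_ge hBr hle hB.nullMeasurableSet (measure_ne_top _ _),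
    he.measurable.comp hs, hsf⟩

/-- The projection of a Borel set is null measurable. -/
theorem MeasurableSet.nullMeasurableSet_image_snd {U Z : Type*} [MeasurableSpace U]
    [StandardBorelSpace U] [MeasurableSpace Z] [StandardBorelSpace Z] {μ : Measure Z}
    [IsFiniteMeasure μ] {G : Set (U × Z)} (hG : MeasurableSet G) :
    NullMeasurableSet {z | ∃ u, (u, z) ∈ G} μ := by
  rcases G.eq_empty_or_nonempty with rfl | hne
  · simp
  have := hne.to_subtype
  have := hG.standardBorel
  obtain ⟨B, -, hB, -, hBe, -⟩ := Measurable.exists_measurable_section μ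
    (f := fun p : G => p.1.2) (measurable_snd.comp measurable_subtype_coe)
  refine hB.nullMeasurableSet.congr (hBe.trans (Filter.EventuallyEq.of_eq ?_))
  ext z
  exact ⟨fun ⟨p, hp⟩ => ⟨p.1.1, by rw [← hp]; exact p.2⟩, fun ⟨u, hu⟩ => ⟨⟨_, hu⟩, rfl⟩⟩

/-- A Borel set with almost surely nonempty sections has a measurable selection defined almost
surely. -/
theorem MeasurableSet.exists_measurable_selection {U Z : Type*} [MeasurableSpace U]
    [StandardBorelSpace U] [MeasurableSpace Z] [StandardBorelSpace Z] {μ : Measure Z}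
    [IsFiniteMeasure μ] [NeZero μ] {G : Set (U × Z)} (hG : MeasurableSet G)
    (h : ∀ᵐ z ∂μ, ∃ u, (u, z) ∈ G) :
    ∃ s : Z → U, Measurable s ∧ ∀ᵐ z ∂μ, (s z, z) ∈ G := by
  obtain ⟨z₀, u₀, hz₀⟩ := h.exists
  have : Nonempty G := ⟨⟨_, hz₀⟩⟩
  have := hG.standardBorel
  obtain ⟨B, s, hB, -, hBe, hs, hsf⟩ := Measurable.exists_measurable_section μ
    (f := fun p : G => p.1.2) (measurable_snd.comp measurable_subtype_coe)
  refine ⟨fun z => (s z).1.1, measurable_fst.comp hs.subtype_val, ?_⟩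
  filter_upwards [h, hBe.mem_iff] with z ⟨u, hu⟩ hz
  have hsz := hsf z (hz.2 ⟨⟨_, hu⟩, rfl⟩)
  have : ((s z).1.1, z) = (s z).1 := Prod.ext rfl hsz.symm
  rw [this]
  exact (s z).2

/-- Weak separation of the origin from a nonempty convex set in finite dimension. -/
theorem Convex.exists_ne_zero_forall_nonpos {E : Type*} [NormedAddCommGroup E] [NormedSpace ℝ E]
    [FiniteDimensional ℝ E] {s : Set E} (hs : Convex ℝ s) (hne : s.Nonempty)
    (h0 : (0 : E) ∉ s) : ∃ f : StrongDual ℝ E, f ≠ 0 ∧ ∀ x ∈ s, f x ≤ 0 := by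
  obtain ⟨x₀, hx₀⟩ := hne
  by_cases hintr : (interior s).Nonempty
  · obtain ⟨f, hf⟩ := geometric_hahn_banach_open_point hs.interior isOpen_interior
      (fun h => h0 (interior_subset h))
    rw [map_zero] at hf
    refine ⟨f, ?_, fun x hx => ?_⟩
    · rintro rfl
      obtain ⟨y, hy⟩ := hintr
      exact lt_irrefl _ (hf y hy)
    · have hx' : x ∈ closure (interior s) := by
        rw [hs.closure_interior_eq_closure_of_nonempty_interior hintr]
        exact subset_closure hx
      exact closure_minimal (t := {y | f y ≤ 0}) (fun y hy => (hf y hy).le)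
        (isClosed_le f.continuous continuous_const) hx'
  · rw [hs.interior_nonempty_iff_affineSpan_eq_top] at hintr
    have hdir : (affineSpan ℝ s).direction < ⊤ := by
      rw [lt_top_iff_ne_top, Ne, AffineSubspace.direction_eq_top_iff_of_nonempty
        ⟨x₀, subset_affineSpan ℝ s hx₀⟩]
      exact hintr
    obtain ⟨f, hf, hker⟩ := Submodule.exists_le_ker_of_lt_top _ hdir
    have hconst : ∀ x ∈ s, f x = f x₀ := by
      intro x hx
      have := hker (AffineSubspace.vsub_mem_direction (subset_affineSpan ℝ s hx)
        (subset_affineSpan ℝ s hx₀))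
      rw [LinearMap.mem_ker, vsub_eq_sub, map_sub] at this
      exact sub_eq_zero.1 this
    rcases le_total (f x₀) 0 with h | h
    · refine ⟨LinearMap.toContinuousLinearMap f, by simpa using hf, fun x hx => ?_⟩
      simpa [hconst x hx] using h
    · refine ⟨LinearMap.toContinuousLinearMap (-f), by simpa using hf, fun x hx => ?_⟩
      simpa [hconst x hx] using h

theorem lt_suppFun2_iff {U Z : Type*} {d : ℕ} {G : Set (U × Z)} {ρ : U → Z → EuclideanSpace ℝ (Fin d)}
    {l : EuclideanSpace ℝ (Fin d)} {z : Z} {c : ℝ} :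
    (c : EReal) < suppFun2 G ρ l z ↔ ∃ u, (u, z) ∈ G ∧ c < ⟪l, ρ u z⟫ := by
  simp only [suppFun2, lt_sSup_iff, exists_mem_image, EReal.coe_lt_coe_iff]
  rfl

theorem suppFun2_ne_bot {U Z : Type*} {d : ℕ} {G : Set (U × Z)} {ρ : U → Z → EuclideanSpace ℝ (Fin d)}
    {l : EuclideanSpace ℝ (Fin d)} {z : Z} (h : (sectionSet G z).Nonempty) :
    suppFun2 G ρ l z ≠ ⊥ := by
  obtain ⟨u, hu⟩ := h
  have := lt_suppFun2_iff (ρ := ρ) (l := l).2 ⟨u, hu, sub_one_lt _⟩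
  exact (bot_le.trans_lt this).ne'

theorem EReal.posPart_neg_lt_ofReal_iff {x : EReal} (hx : x ≠ ⊥) {c : ℝ} (hc : 0 < c) :
    (-x).posPart < ENNReal.ofReal c ↔ ((-c : ℝ) : EReal) < x := by
  induction x with
  | bot => exact absurd rfl hx
  | top => simpa [EReal.posPart, hc] using EReal.coe_lt_top (-c)
  | coe x =>
    rw [← EReal.coe_neg, EReal.posPart, if_neg (EReal.coe_ne_top _), EReal.toReal_coe,
      ENNReal.ofReal_lt_ofReal_iff hc, EReal.coe_lt_coe_iff, neg_lt]

theorem EReal.posPart_neg_ne_top {x : EReal} (hx : x ≠ ⊥) : (-x).posPart ≠ ⊤ := by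
  rw [EReal.posPart, if_neg (by simpa using hx)]
  exact ENNReal.ofReal_ne_top

theorem EReal.coe_sub_posPart_neg_sub_lt {x : EReal} (hx : x ≠ ⊥) {c : NNReal}
    (hc : (c : ℝ≥0∞) ≤ x.posPart) {δ : ℝ} (hδ : 0 < δ) :
    ((c - (-x).posPart.toReal - δ : ℝ) : EReal) < x := by
  induction x with
  | bot => exact absurd rfl hx
  | top => exact EReal.coe_lt_top _
  | coe x =>
    rw [EReal.posPart, if_neg (EReal.coe_ne_top _), EReal.toReal_coe] at hc
    rw [← EReal.coe_neg, EReal.posPart, if_neg (EReal.coe_ne_top _), EReal.toReal_coe,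
      EReal.coe_lt_coe_iff, ENNReal.toReal_ofReal']
    have hc' : (c : ℝ) ≤ max x 0 := by
      have := ENNReal.toReal_mono ENNReal.ofReal_ne_top hc
      rwa [ENNReal.coe_toReal, ENNReal.toReal_ofReal'] at this
    rcases le_total x 0 with h | h
    · rw [max_eq_right h] at hc'
      rw [max_eq_left (by linarith)]
      linarith
    · rw [max_eq_left h] at hc'
      rw [max_eq_right (by linarith)]
      linarith

theorem aemeasurable_posPart_neg_suppFun2 {U Z : Type*} [MeasurableSpace U] [StandardBorelSpace U]
    [MeasurableSpace Z] [StandardBorelSpace Z] {d : ℕ} {F : Measure Z} [IsFiniteMeasure F]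
    {G : Set (U × Z)} (hG : MeasurableSet G) (hne : ∀ z, (sectionSet G z).Nonempty)
    {ρ : U → Z → EuclideanSpace ℝ (Fin d)} (hρ : Measurable fun p : U × Z => ρ p.1 p.2)
    (l : EuclideanSpace ℝ (Fin d)) :
    AEMeasurable (fun z => (-(suppFun2 G ρ l z)).posPart) F := by
  refine NullMeasurable.aemeasurable ?_
  refine measurable_of_Iio (mα := inferInstance)
    (mδ := (inferInstance : MeasurableSpace (NullMeasurableSpace Z F))) fun a => ?_
  change NullMeasurableSet {z | (-(suppFun2 G ρ l z)).posPart < a} F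
  rcases eq_or_ne a ⊤ with rfl | ha
  · simp [lt_top_iff_ne_top, EReal.posPart_neg_ne_top (suppFun2_ne_bot (hne _))]
  rcases eq_or_ne a 0 with rfl | ha0
  · simp
  have hc := ENNReal.toReal_pos ha0 ha
  have hset : {z | (-(suppFun2 G ρ l z)).posPart < a} =
      {z | ∃ u, (u, z) ∈ G ∩ {p | -a.toReal < ⟪l, ρ p.1 p.2⟫}} := by
    ext z
    rw [← ENNReal.ofReal_toReal ha]
    simp only [mem_ofPred_eq, EReal.posPart_neg_lt_ofReal_iff (suppFun2_ne_bot (hne z)) hc,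
      lt_suppFun2_iff, mem_inter_iff]
    rw [ENNReal.ofReal_toReal ha]
  rw [hset]
  exact (hG.inter (measurableSet_lt measurable_const
    (measurable_const.inner hρ))).nullMeasurableSet_image_snd

/-- A positive integral of the support function is witnessed by an integrable strict minorant
with positive integral. -/
theorem exists_integrable_lt_suppFun2 {U Z : Type*} [MeasurableSpace U] [StandardBorelSpace U]
    [MeasurableSpace Z] [StandardBorelSpace Z] {d : ℕ} {F : Measure Z} [IsFiniteMeasure F]
    {G : Set (U × Z)} (hG : MeasurableSet G) (hne : ∀ z, (sectionSet G z).Nonempty)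
    {ρ : U → Z → EuclideanSpace ℝ (Fin d)} (hρ : Measurable fun p : U × Z => ρ p.1 p.2)
    {l : EuclideanSpace ℝ (Fin d)} (hpos : 0 < integralEReal F (suppFun2 G ρ l)) :
    ∃ v : Z → ℝ, Measurable v ∧ Integrable v F ∧ 0 < ∫ z, v z ∂F ∧
      ∀ᵐ z ∂F, ∃ u, (u, z) ∈ G ∧ v z < ⟪l, ρ u z⟫ := by
  have hbot : ∀ z, suppFun2 G ρ l z ≠ ⊥ := fun z => suppFun2_ne_bot (hne z)
  have hk := aemeasurable_posPart_neg_suppFun2 (F := F) hG hne hρ l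
  rw [integralEReal, EReal.sub_pos, EReal.coe_ennreal_lt_coe_ennreal_iff] at hpos
  have hktop := hpos.ne_top
  rw [lintegral_eq_nnreal (fun z => (suppFun2 G ρ l z).posPart)] at hpos
  simp only [lt_iSup_iff] at hpos
  obtain ⟨s, hs, hlt⟩ := hpos
  rw [← SimpleFunc.lintegral_eq_lintegral] at hlt
  simp only [SimpleFunc.map_apply] at hlt
  have hsi : Integrable (fun z => (s z : ℝ)) F :=
    (s.map NNReal.toReal).integrable_of_isFiniteMeasure
  have hsint : ∫ z, (s z : ℝ) ∂F = (∫⁻ z, (s z : ℝ≥0∞) ∂F).toReal :=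
    integral_toReal s.measurable.coe_nnreal_ennreal.aemeasurable (by simp)
  have hs_fin : ∫⁻ z, (s z : ℝ≥0∞) ∂F ≠ ⊤ := by
    have := hsi.lintegral_lt_top
    simp only [ENNReal.ofReal_coe_nnreal] at this
    exact this.ne
  have hki := integrable_toReal_of_lintegral_ne_top hk hktop
  have hkint := integral_toReal hk (ae_lt_top' hk hktop)
  have hgap : (∫⁻ z, (-(suppFun2 G ρ l z)).posPart ∂F).toReal <
      (∫⁻ z, (s z : ℝ≥0∞) ∂F).toReal := (ENNReal.toReal_lt_toReal hktop hs_fin).2 hlt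
  rw [← hkint, ← hsint] at hgap
  obtain ⟨k, hkm, hkk⟩ : AEMeasurable (fun z => (-(suppFun2 G ρ l z)).posPart.toReal) F :=
    hk.ennreal_toReal
  rw [integral_congr_ae hkk] at hgap
  replace hki := hki.congr hkk
  obtain ⟨δ, hδ, hδgap⟩ : ∃ δ > 0, δ * F.real univ < ∫ z, (s z : ℝ) ∂F - ∫ z, k z ∂F := by
    refine ⟨(∫ z, (s z : ℝ) ∂F - ∫ z, k z ∂F) / (F.real univ + 1),
      div_pos (sub_pos.2 hgap) (by positivity), ?_⟩
    have hD := sub_pos.2 hgap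
    rw [div_mul_eq_mul_div, div_lt_iff₀ (by positivity)]
    nlinarith
  refine ⟨fun z => s z - k z - δ,
    ((s.measurable.coe_nnreal_real.sub hkm).sub measurable_const),
    (hsi.sub hki).sub (integrable_const δ), ?_, ?_⟩
  · have hintr : ∫ z, (s z - k z - δ) ∂F = ∫ z, (s z : ℝ) ∂F - ∫ z, k z ∂F - F.real univ * δ := by
      rw [integral_sub (f := fun z => s z - k z) (hsi.sub hki) (integrable_const δ),
        integral_sub hsi hki, integral_const, smul_eq_mul]
    rw [hintr]
    linarith
  · filter_upwards [hkk] with z hz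
    rw [← lt_suppFun2_iff, ← hz]
    exact EReal.coe_sub_posPart_neg_sub_lt (hbot z) (hs z) hδ

/-- A positive integral of the support function is witnessed by an integrable selection. -/
theorem exists_selection_integral_inner_pos {U Z : Type*} [MeasurableSpace U] [StandardBorelSpace U]
    [MeasurableSpace Z] [StandardBorelSpace Z] {d : ℕ} {F : Measure Z} [IsProbabilityMeasure F]
    {G : Set (U × Z)} (hG : MeasurableSet G) (hne : ∀ z, (sectionSet G z).Nonempty)
    {ρ : U → Z → EuclideanSpace ℝ (Fin d)} (hρ : Measurable fun p : U × Z => ρ p.1 p.2)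
    {u₀ : Z → U} (hu₀ : Measurable u₀) (hu₀G : ∀ᵐ z ∂F, (u₀ z, z) ∈ G)
    (hu₀i : Integrable (fun z => ρ (u₀ z) z) F)
    {l : EuclideanSpace ℝ (Fin d)} (hpos : 0 < integralEReal F (suppFun2 G ρ l)) :
    ∃ u : Z → U, Measurable u ∧ (∀ᵐ z ∂F, (u z, z) ∈ G) ∧
      Integrable (fun z => ρ (u z) z) F ∧ 0 < ⟪l, ∫ z, ρ (u z) z ∂F⟫ := by
  classical
  obtain ⟨v, hv, hvi, hvpos, hvG⟩ := exists_integrable_lt_suppFun2 (F := F) hG hne hρ hpos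
  obtain ⟨w, hw, hwG⟩ := (hG.inter (measurableSet_lt (hv.comp measurable_snd)
    (measurable_const.inner hρ))).exists_measurable_selection hvG
  have hρw : Measurable fun z => ρ (w z) z := hρ.comp (hw.prodMk measurable_id)
  have hρu₀ : Measurable fun z => ρ (u₀ z) z := hρ.comp (hu₀.prodMk measurable_id)
  let A : ℕ → Set Z := fun n => {z | ‖ρ (w z) z‖ ≤ n}
  have hA : ∀ n, MeasurableSet (A n) := fun n => measurableSet_le hρw.norm measurable_const
  have hu₀l : Integrable (fun z => ⟪l, ρ (u₀ z) z⟫) F := hu₀i.const_inner l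
  have hlim : Filter.Tendsto (fun n => ∫ z, (A n).piecewise v (fun z => ⟪l, ρ (u₀ z) z⟫) z ∂F)
      Filter.atTop (nhds (∫ z, v z ∂F)) := by
    refine tendsto_integral_of_dominated_convergence
      (fun z => ‖v z‖ + ‖⟪l, ρ (u₀ z) z⟫‖) (fun n => ?_) (hvi.norm.add hu₀l.norm)
      (fun n => ?_) ?_
    · exact (hv.piecewise (hA n) (measurable_const.inner hρu₀)).aestronglyMeasurable
    · refine Filter.Eventually.of_forall fun z => ?_
      by_cases hz : z ∈ A n
      · simp [hz]
      · simp [hz]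
    · refine Filter.Eventually.of_forall fun z => ?_
      obtain ⟨N, hN⟩ := exists_nat_ge ‖ρ (w z) z‖
      refine tendsto_const_nhds.congr' ?_
      filter_upwards [Filter.eventually_ge_atTop N] with n hn
      have hz : z ∈ A n := hN.trans (Nat.cast_le.2 hn)
      simp [hz]
  obtain ⟨n, hn⟩ := (hlim.eventually_const_lt hvpos).exists
  have hpw : ∀ z, ρ ((A n).piecewise w u₀ z) z =
      (A n).piecewise (fun z => ρ (w z) z) (fun z => ρ (u₀ z) z) z := by
    intro z
    by_cases hz : z ∈ A n <;> simp [hz]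
  have hi : Integrable (fun z => ρ ((A n).piecewise w u₀ z) z) F := by
    simp only [hpw]
    refine Integrable.mono' ((integrable_const (n : ℝ)).add hu₀i.norm)
      (hρw.piecewise (hA n) hρu₀).aestronglyMeasurable (Filter.Eventually.of_forall fun z => ?_)
    by_cases hz : z ∈ A n
    · simpa [hz] using (show ‖ρ (w z) z‖ ≤ n from hz).trans
        (le_add_of_nonneg_right (norm_nonneg (ρ (u₀ z) z)))
    · simp [hz]
  refine ⟨(A n).piecewise w u₀, hw.piecewise (hA n) hu₀, ?_, hi, ?_⟩
  · filter_upwards [hwG, hu₀G] with z hz hz₀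
    by_cases hzA : z ∈ A n
    · simpa [hzA] using hz.1
    · simpa [hzA] using hz₀
  · rw [← integral_inner hi]
    refine hn.trans_le (integral_mono_ae ?_ (hi.const_inner l) ?_)
    · refine Integrable.mono' (hvi.norm.add hu₀l.norm)
        (hv.piecewise (hA n) (measurable_const.inner hρu₀)).aestronglyMeasurable
        (Filter.Eventually.of_forall fun z => ?_)
      by_cases hz : z ∈ A n <;> simp [hz]
    · filter_upwards [hwG] with z hz
      by_cases hzA : z ∈ A n
      · simpa [hzA] using hz.2.le
      · simp [hzA]

/-- The means of `ρ` over the couplings supported on `G` with marginal `F`. -/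
def couplingMeans {U Z : Type*} [MeasurableSpace U] [MeasurableSpace Z]
    {d : ℕ} (G : Set (U × Z)) (ρ : U → Z → EuclideanSpace ℝ (Fin d))
    (F : Measure Z) : Set (EuclideanSpace ℝ (Fin d)) :=
  {m | ∃ H : Measure (U × Z), IsProbabilityMeasure H ∧ H G = 1 ∧ H.map Prod.snd = F ∧
    Integrable (fun p : U × Z => ρ p.1 p.2) H ∧ ∫ p : U × Z, ρ p.1 p.2 ∂H = m}

theorem convex_couplingMeans {U Z : Type*} [MeasurableSpace U] [MeasurableSpace Z]
    {d : ℕ} (G : Set (U × Z))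
    (ρ : U → Z → EuclideanSpace ℝ (Fin d)) (F : Measure Z) :
    Convex ℝ (couplingMeans G ρ F) := by
  rintro _ ⟨H₁, hH₁, hG₁, hF₁, hi₁, rfl⟩ _ ⟨H₂, hH₂, hG₂, hF₂, hi₂, rfl⟩ a b ha hb hab
  have hab' : ENNReal.ofReal a + ENNReal.ofReal b = 1 := by
    rw [← ENNReal.ofReal_add ha hb, hab, ENNReal.ofReal_one]
  have hi₁' := hi₁.smul_measure (c := ENNReal.ofReal a) ENNReal.ofReal_ne_top
  have hi₂' := hi₂.smul_measure (c := ENNReal.ofReal b) ENNReal.ofReal_ne_top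
  refine ⟨ENNReal.ofReal a • H₁ + ENNReal.ofReal b • H₂, ⟨?_⟩, ?_, ?_,
    hi₁'.add_measure hi₂', ?_⟩
  · simp [hab']
  · simp [hG₁, hG₂, hab']
  · rw [Measure.map_add _ _ measurable_snd, Measure.map_smul, Measure.map_smul, hF₁, hF₂,
      ← add_smul, hab', one_smul]
  · rw [integral_add_measure hi₁' hi₂', integral_smul_measure, integral_smul_measure,
      ENNReal.toReal_ofReal ha, ENNReal.toReal_ofReal hb]

theorem integral_selection_mem_couplingMeans {U Z : Type*} [MeasurableSpace U] [MeasurableSpace Z]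
    {d : ℕ} {F : Measure Z} [IsProbabilityMeasure F]
    {G : Set (U × Z)} (hG : MeasurableSet G)
    {ρ : U → Z → EuclideanSpace ℝ (Fin d)} (hρ : Measurable fun p : U × Z => ρ p.1 p.2)
    {u : Z → U} (hu : Measurable u) (huG : ∀ᵐ z ∂F, (u z, z) ∈ G)
    (hui : Integrable (fun z => ρ (u z) z) F) :
    ∫ z, ρ (u z) z ∂F ∈ couplingMeans G ρ F := by
  have hφ : Measurable fun z => (u z, z) := hu.prodMk measurable_id
  refine ⟨F.map fun z => (u z, z), Measure.isProbabilityMeasure_map hφ.aemeasurable, ?_, ?_, ?_, ?_⟩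
  · rw [Measure.map_apply hφ hG]
    exact (prob_compl_eq_zero_iff (hφ hG)).1 huG
  · rw [Measure.map_map measurable_snd hφ]
    exact Measure.map_id
  · exact (integrable_map_measure hρ.aestronglyMeasurable hφ.aemeasurable).2 hui
  · exact integral_map hφ.aemeasurable hρ.aestronglyMeasurable

/-- A positive integrated support function in every direction makes zero a coupling mean. -/
theorem zero_mem_couplingMeans {U Z : Type*} [MeasurableSpace U] [StandardBorelSpace U]
    [MeasurableSpace Z] [StandardBorelSpace Z] {d : ℕ} {F : Measure Z} [IsProbabilityMeasure F]
    {G : Set (U × Z)} (hG : MeasurableSet G) (hne : ∀ z, (sectionSet G z).Nonempty)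
    {ρ : U → Z → EuclideanSpace ℝ (Fin d)} (hρ : Measurable fun p : U × Z => ρ p.1 p.2)
    {u₀ : Z → U} (hu₀ : Measurable u₀) (hu₀G : ∀ᵐ z ∂F, (u₀ z, z) ∈ G)
    (hu₀i : Integrable (fun z => ρ (u₀ z) z) F)
    (hpos : ∀ l : EuclideanSpace ℝ (Fin d), ‖l‖ = 1 →
      0 < integralEReal F (suppFun2 G ρ l)) :
    (0 : EuclideanSpace ℝ (Fin d)) ∈ couplingMeans G ρ F := by
  by_contra h0
  obtain ⟨f, hf, hfle⟩ := (convex_couplingMeans G ρ F).exists_ne_zero_forall_nonpos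
    ⟨_, integral_selection_mem_couplingMeans hG hρ hu₀ hu₀G hu₀i⟩ h0
  obtain ⟨a, rfl⟩ := (InnerProductSpace.toDual ℝ (EuclideanSpace ℝ (Fin d))).surjective f
  have ha : a ≠ 0 := by
    rintro rfl
    exact hf (map_zero _)
  obtain ⟨u, hu, huG, hui, hupos⟩ := exists_selection_integral_inner_pos hG hne hρ hu₀ hu₀G hu₀i
    (hpos (‖a‖⁻¹ • a) (by simp [norm_smul, ha]))
  have hle := hfle _ (integral_selection_mem_couplingMeans hG hρ hu huG hui)
  rw [InnerProductSpace.toDual_apply_apply] at hle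
  rw [real_inner_smul_left] at hupos
  exact (mul_nonpos_of_nonneg_of_nonpos (inv_nonneg.2 (norm_nonneg a)) hle).not_gt hupos

/-- Concatenation of Euclidean vectors, as a continuous linear map. -/
def appendCLM (d1 d2 : ℕ) :
    EuclideanSpace ℝ (Fin d1) × EuclideanSpace ℝ (Fin d2) →L[ℝ]
      EuclideanSpace ℝ (Fin (d1 + d2)) :=
  LinearMap.toContinuousLinearMap
    { toFun := fun p => WithLp.toLp 2 (Fin.append (WithLp.ofLp p.1) (WithLp.ofLp p.2))
      map_add' := fun p q => by
        ext i
        refine Fin.addCases (fun j => ?_) (fun j => ?_) i <;> simp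
      map_smul' := fun c p => by
        ext i
        refine Fin.addCases (fun j => ?_) (fun j => ?_) i <;> simp }

theorem appendCLM_apply_eq_rComb {U Z : Type*} {d1 d2 : ℕ} (r1 : Z → EuclideanSpace ℝ (Fin d1))
    (r2 : U → Z → EuclideanSpace ℝ (Fin d2)) (u : U) (z : Z) :
    appendCLM d1 d2 (r1 z, r2 u z) = rComb r1 r2 u z :=
  rfl

theorem norm_le_norm_rComb {U Z : Type*} {d1 d2 : ℕ} (r1 : Z → EuclideanSpace ℝ (Fin d1))
    (r2 : U → Z → EuclideanSpace ℝ (Fin d2)) (u : U) (z : Z) :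
    ‖r2 u z‖ ≤ ‖rComb r1 r2 u z‖ := by
  rw [EuclideanSpace.norm_eq, EuclideanSpace.norm_eq]
  refine Real.sqrt_le_sqrt ?_
  rw [Fin.sum_univ_add]
  refine le_add_of_nonneg_of_le (by positivity) (le_of_eq ?_)
  simp [rComb]

theorem measurable_of_measurable_rComb {U Z : Type*} [MeasurableSpace U] [MeasurableSpace Z]
    {d1 d2 : ℕ} {r1 : Z → EuclideanSpace ℝ (Fin d1)} {r2 : U → Z → EuclideanSpace ℝ (Fin d2)}
    (h : Measurable fun p : U × Z => rComb r1 r2 p.1 p.2) :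
    Measurable fun p : U × Z => r2 p.1 p.2 := by
  refine (WithLp.measurable_toLp 2 _).comp (measurable_pi_lambda _ fun i => ?_)
  have := (measurable_pi_apply (Fin.natAdd d1 i)).comp ((WithLp.measurable_ofLp 2 _).comp h)
  simpa [Function.comp_def, rComb] using this

/-- The lower envelope yields a measurable selection along which `r₂` is integrable. -/
theorem Assumption1At.exists_integrable_selection {U Z : Type*}
    [MeasurableSpace U] [StandardBorelSpace U] [MeasurableSpace Z] [StandardBorelSpace Z]
    {d1 d2 : ℕ} {F : Measure Z} [IsProbabilityMeasure F] {G : Set (U × Z)}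
    {r1 : Z → EuclideanSpace ℝ (Fin d1)} {r2 : U → Z → EuclideanSpace ℝ (Fin d2)}
    (h : Assumption1At F G (rComb r1 r2)) :
    ∃ u : Z → U, Measurable u ∧ (∀ᵐ z ∂F, (u z, z) ∈ G) ∧
      Integrable (fun z => r2 (u z) z) F := by
  obtain ⟨g, hg, hgi, hle⟩ := h.lower_envelope
  have hsec : ∀ᵐ z ∂F, ∃ u, (u, z) ∈ G ∩ {p | ‖rComb r1 r2 p.1 p.2‖ < g p.2 + 1} := by
    filter_upwards [hle] with z hz
    obtain ⟨_, ⟨_, ⟨u, hu, rfl⟩, rfl⟩, hlt⟩ := exists_lt_of_csInf_lt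
      (((h.nonempty_section z).image _).image _) (hz.trans_lt (lt_add_one (g z)))
    exact ⟨u, hu, hlt⟩
  obtain ⟨u, hu, huG⟩ := (h.borel_Gamma.inter (measurableSet_lt h.measurable_r.norm
    ((hg.comp measurable_snd).add_const 1))).exists_measurable_selection hsec
  refine ⟨u, hu, huG.mono fun z hz => hz.1, ?_⟩
  refine Integrable.mono' (hgi.add (integrable_const 1))
    ((measurable_of_measurable_rComb h.measurable_r).comp
      (hu.prodMk measurable_id)).aestronglyMeasurable ?_
  filter_upwards [huG] with z hz
  exact (norm_le_norm_rComb r1 r2 _ _).trans hz.2.le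

/-- **Lemma C.1, part (i) (sufficient condition for membership in the identified set).**
Suppose Assumption 1 holds, `F ∈ 𝓕`, `θ ∈ Θ`, and `r₁(·;θ)` is `F`-integrable.
If `∫ r₁(z;θ) dF = 0` and `inf_{λ ∈ 𝒮₂} ∫ γ₂(λ,z;θ) dF > 0` (including the case where the
infimum equals `+∞`, in particular when `dim r₂ = 0`), then `θ ∈ Θ_I(F)`. -/
theorem mem_identified_of_pos_inf {d1 d2 : ℕ}
    (𝓕 : Set (Measure 𝓩)) (hprob : ∀ F ∈ 𝓕, IsProbabilityMeasure F)
    (Γ : Θ → Set (𝓤 × 𝓩)) (r1 : Θ → 𝓩 → EuclideanSpace ℝ (Fin d1))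
    (r2 : Θ → 𝓤 → 𝓩 → EuclideanSpace ℝ (Fin d2))
    (h1 : Assumption1 𝓕 Γ (fun θ => rComb (r1 θ) (r2 θ)))
    (F : Measure 𝓩) (hF : F ∈ 𝓕) (θ : Θ)
    (hr1int : Integrable (r1 θ) F)
    (hmom : ∫ z, r1 θ z ∂F = 0)
    (hinf : (0 : EReal) < ⨅ l : {l : EuclideanSpace ℝ (Fin d2) // ‖l‖ = 1},
        integralEReal F (suppFun2 (Γ θ) (r2 θ) l.1)) :
    MemIdentified (Γ θ) (rComb (r1 θ) (r2 θ)) F := by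
  have := hprob F hF
  have hA := h1 θ F hF
  have hρ := measurable_of_measurable_rComb hA.measurable_r
  obtain ⟨u₀, hu₀, hu₀G, hu₀i⟩ := hA.exists_integrable_selection
  have hpos : ∀ l : EuclideanSpace ℝ (Fin d2), ‖l‖ = 1 →
      0 < integralEReal F (suppFun2 (Γ θ) (r2 θ) l) := fun l hl =>
    hinf.trans_le (iInf_le (fun l : {l : EuclideanSpace ℝ (Fin d2) // ‖l‖ = 1} =>
      integralEReal F (suppFun2 (Γ θ) (r2 θ) l.1)) ⟨l, hl⟩)
  have hmem := zero_mem_couplingMeans hA.borel_Gamma hA.nonempty_section hρ hu₀ hu₀G hu₀i hpos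
  simp only [couplingMeans, mem_ofPred_eq] at hmem
  obtain ⟨H, hH, hHG, hHF, hHi, hH0⟩ := hmem
  have hr1H : Integrable (r1 θ) (H.map Prod.snd) := by rwa [hHF]
  have hr1i : Integrable (fun p : 𝓤 × 𝓩 => r1 θ p.2) H := hr1H.comp_measurable measurable_snd
  have hr10 : ∫ p : 𝓤 × 𝓩, r1 θ p.2 ∂H = 0 := by
    rw [← integral_map measurable_snd.aemeasurable hr1H.aestronglyMeasurable, hHF, hmom]
  have hpair := hr1i.prodMk hHi
  simp only [MemIdentified, ← appendCLM_apply_eq_rComb]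
  refine ⟨H, hH, hHG, hHF, (appendCLM d1 d2).integrable_comp hpair, ?_⟩
  rw [(appendCLM d1 d2).integral_comp_comm hpair, integral_pair hr1i hHi, hr10, hH0]
  exact map_zero _

end
end
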